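/- Let x be a solution of x' = h(t,x) defined on a maximal interval (α, β). If liminf_{t→β⁻} x(t) = −∞, then β < ∞; if limsup_{t→α⁺} x(t) = ∞, then α > −∞. In particular, every globally defined solution of x' = h(t,x) is bounded. -/

import Mathlib

open Set Filter

/-- `x` is a solution of `x' = h t x` on the open interval `(α, β)` of extended reals. -/
def IsSolOn (h : ℝ → ℝ → ℝ) (x : ℝ → ℝ) (α β : EReal) : Prop :=
  ∀ t : ℝ, α < (t : EReal) → (t : EReal) < β → HasDerivAt x (h t (x t)) t

/-- `x` is a maximal solution of `x' = h t x` on `(α, β)`: it is a solution there,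
the interval is nonempty, and no solution extends it to a strictly larger open interval. -/
def IsMaxSolOn (h : ℝ → ℝ → ℝ) (x : ℝ → ℝ) (α β : EReal) : Prop :=
  α < β ∧ IsSolOn h x α β ∧
  ∀ (α' β' : EReal) (y : ℝ → ℝ), α' ≤ α → β ≤ β' → IsSolOn h y α' β' →
    (∀ t : ℝ, α < (t : EReal) → (t : EReal) < β → y t = x t) → α' = α ∧ β' = β

/-- A differentiable function on `[a, ∞)` satisfying `x' ≤ -μ x²` whenever `x ≤ -M` cannot start
below `-M`: it would blow up in finite time. -/
lemma neg_lt_of_hasDerivAt_le_neg_mul_sq {x x' : ℝ → ℝ} {a μ M : ℝ} (hμ : 0 < μ) (hM : 0 < M)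
    (hx : ∀ t, a ≤ t → HasDerivAt x (x' t) t)
    (hx' : ∀ t, a ≤ t → x t ≤ -M → x' t ≤ -μ * x t ^ 2) : -M < x a := by
  by_contra! ha
  have hle : ∀ t, a ≤ t → x t ≤ -M := fun t ht =>
    image_le_of_deriv_right_lt_deriv_boundary (B := fun _ => -M) (B' := fun _ => 0)
      (fun s hs => (hx s hs.1).continuousAt.continuousWithinAt)
      (fun s hs => (hx s hs.1).hasDerivWithinAt) ha (fun s => hasDerivAt_const s _)
      (fun s hs hsM => by
        have h := hx' s hs.1 hsM.le
        rw [hsM] at h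
        nlinarith [mul_pos hμ (pow_pos hM 2)]) (right_mem_Icc.2 ht)
  have hneg : ∀ t, a ≤ t → x t < 0 := fun t ht => by linarith [hle t ht]
  have hinv : ∀ t, a ≤ t → HasDerivAt (fun s => (x s)⁻¹) (-x' t / x t ^ 2) t :=
    fun t ht => (hx t ht).inv (hneg t ht).ne
  have hpos : 0 < 1 / (μ * M) := by positivity
  have hab : a ≤ a + 1 / (μ * M) := by linarith
  have hgrow := (convex_Icc a (a + 1 / (μ * M))).mul_sub_le_image_sub_of_le_deriv
    (f := fun s => (x s)⁻¹) (C := μ)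
    (fun s hs => (hinv s hs.1).continuousAt.continuousWithinAt)
    (fun s hs => (hinv s (interior_subset hs).1).differentiableAt.differentiableWithinAt)
    (fun s hs => by
      have hs' := (interior_subset hs).1
      rw [(hinv s hs').deriv, le_div_iff₀ (sq_pos_of_neg (hneg s hs'))]
      linarith [hx' s hs' (hle s hs')])
    a (left_mem_Icc.2 hab) _ (right_mem_Icc.2 hab) hab
  have hstep : μ * (a + 1 / (μ * M) - a) = M⁻¹ := by
    field_simp
    ring
  have hstart : -M⁻¹ ≤ (x a)⁻¹ := by
    rw [← inv_neg]
    exact (inv_le_inv_of_neg (by linarith) (hneg a le_rfl)).2 ha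
  have hend := inv_lt_zero.2 (hneg _ hab)
  linarith

/-- Time-reversed form: a differentiable function on `(-∞, a]` satisfying `x' ≤ -μ x²` whenever
`M ≤ x` cannot end above `M`. -/
lemma lt_of_hasDerivAt_le_neg_mul_sq {x x' : ℝ → ℝ} {a μ M : ℝ} (hμ : 0 < μ) (hM : 0 < M)
    (hx : ∀ t, t ≤ a → HasDerivAt x (x' t) t)
    (hx' : ∀ t, t ≤ a → M ≤ x t → x' t ≤ -μ * x t ^ 2) : x a < M := by
  have h := neg_lt_of_hasDerivAt_le_neg_mul_sq (x := fun t => -x (-t)) (x' := fun t => x' (-t))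
    (a := -a) hμ hM
    (fun t ht => ((hx (-t) (by linarith)).scomp t (hasDerivAt_neg t)).neg.congr_deriv (by simp))
    (fun t ht htM => by
      simpa using hx' (-t) (by linarith) (by linarith))
  simpa using h

theorem stmt2 (h : ℝ → ℝ → ℝ)
    (hcont : Continuous fun q : ℝ × ℝ => h q.1 q.2)
    (hlip : ∀ q : ℝ × ℝ, ∃ K : ℝ, ∃ U ∈ nhds q, ∀ t x y : ℝ,
      (t, x) ∈ U → (t, y) ∈ U → |h t x - h t y| ≤ K * |x - y|)
    (hcoer : ∃ μ > (0:ℝ), ∃ M > (0:ℝ), ∀ t x : ℝ, M ≤ |x| → h t x ≤ -μ * x ^ 2) :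
    (∀ (x : ℝ → ℝ) (α β : EReal), IsMaxSolOn h x α β →
      -- if liminf_{t→β⁻} x t = −∞ then β < ∞
      ((∀ C : ℝ, ∀ t₀ : ℝ, (t₀ : EReal) < β → ∃ t : ℝ, t₀ < t ∧ (t : EReal) < β ∧ x t < C) →
        β ≠ ⊤) ∧
      -- if limsup_{t→α⁺} x t = ∞ then α > −∞
      ((∀ C : ℝ, ∀ t₀ : ℝ, α < (t₀ : EReal) → ∃ t : ℝ, t < t₀ ∧ α < (t : EReal) ∧ C < x t) →
        α ≠ ⊥)) ∧
    -- in particular, any globally defined solution is bounded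
    (∀ x : ℝ → ℝ, (∀ t : ℝ, HasDerivAt x (h t (x t)) t) → ∃ C : ℝ, ∀ t, |x t| ≤ C) := by
  obtain ⟨μ, hμ, M, hM, hle⟩ := hcoer
  have hlow : ∀ (x : ℝ → ℝ) (a : ℝ), (∀ t, a ≤ t → HasDerivAt x (h t (x t)) t) → -M < x a :=
    fun x a hx => neg_lt_of_hasDerivAt_le_neg_mul_sq hμ hM hx
      fun t _ htM => hle t _ (le_abs.2 (Or.inr (by linarith)))
  have hupp : ∀ (x : ℝ → ℝ) (a : ℝ), (∀ t, t ≤ a → HasDerivAt x (h t (x t)) t) → x a < M :=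
    fun x a hx => lt_of_hasDerivAt_le_neg_mul_sq hμ hM hx
      fun t _ htM => hle t _ (le_abs.2 (Or.inl htM))
  refine ⟨fun x α β hmax => ⟨?_, ?_⟩, fun x hx => ⟨M, fun t =>
    abs_le.2 ⟨(hlow x t fun s _ => hx s).le, (hupp x t fun s _ => hx s).le⟩⟩⟩
  · rintro hinf rfl
    obtain ⟨t₀, ht₀, -⟩ := EReal.lt_iff_exists_real_btwn.1 hmax.1
    obtain ⟨t, ht, -, hxt⟩ := hinf (-M) t₀ (EReal.coe_lt_top _)
    refine hxt.not_gt (hlow x t fun s hs => hmax.2.1 s (ht₀.trans ?_) (EReal.coe_lt_top _))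
    exact EReal.coe_lt_coe_iff.2 (ht.trans_le hs)
  · rintro hsup rfl
    obtain ⟨t₀, -, ht₀⟩ := EReal.lt_iff_exists_real_btwn.1 hmax.1
    obtain ⟨t, ht, -, hxt⟩ := hsup M t₀ (EReal.bot_lt_coe _)
    refine hxt.not_gt (hupp x t fun s hs => hmax.2.1 s (EReal.bot_lt_coe _) (lt_trans ?_ ht₀))
    exact EReal.coe_lt_coe_iff.2 (hs.trans_lt ht)
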